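/- Let d ≥ 1, c > 0, and let q : ℝ × ℝ^d × ℝ^d → ℂ be measurable with |q(s,x,ξ)| ≤ c(1 + |ξ|²) for all s, x, ξ. For f ∈ C_c^∞(ℝ × ℝ^d; ℂ) define the operator L by Lf(s,x) := ∂f/∂s(s,x) − (2π)^{−d/2} ∫_{ℝ^d} e^{i x·ξ} q(s,x,ξ) (f(s,·))^∧(ξ) dξ, where (f(s,·))^∧ denotes the d-dimensional Fourier transform of x ↦ f(s,x). Then for every f ∈ C_c^∞(ℝ × ℝ^d; ℂ) and every (s,x), both integrals below converge absolutely and −Lf(s,x) = (2π)^{−(d+1)/2} ∫_{ℝ^{1+d}} e^{i(sσ + x·ξ)} (−iσ + q(s,x,ξ)) f̂(σ,ξ) dσ dξ, where f̂ is the (1+d)-dimensional Fourier transform of f. In other words, −L is a pseudo-differential operator on C_c^∞(ℝ^{1+d}) with symbol q_L((s,x),(σ,ξ)) = −iσ + q(s,x,ξ). -/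

import Mathlib

open Filter Topology MeasureTheory Complex
open scoped ZeroAtInfty RealInnerProductSpace

/-- The `d`-dimensional Fourier transform with convention
`ĝ(ξ) = (2π)^{-d/2} ∫ e^{-i x·ξ} g(x) dx`. -/
noncomputable def fourierD (d : ℕ) (g : EuclideanSpace ℝ (Fin d) → ℂ)
    (ξ : EuclideanSpace ℝ (Fin d)) : ℂ :=
  (((2 * Real.pi) ^ (-(d : ℝ) / 2) : ℝ) : ℂ) *
    ∫ x : EuclideanSpace ℝ (Fin d), Complex.exp (-(⟪x, ξ⟫ : ℝ) * Complex.I) * g x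

/-- The `(1+d)`-dimensional Fourier transform of `f : ℝ × ℝ^d → ℂ` with convention
`f̂(σ,ξ) = (2π)^{-(1+d)/2} ∫∫ e^{-i(sσ + x·ξ)} f(s,x) ds dx`. -/
noncomputable def fourierTD (d : ℕ) (f : ℝ × EuclideanSpace ℝ (Fin d) → ℂ)
    (σ : ℝ) (ξ : EuclideanSpace ℝ (Fin d)) : ℂ :=
  (((2 * Real.pi) ^ (-((1 : ℝ) + d) / 2) : ℝ) : ℂ) *
    ∫ p : ℝ × EuclideanSpace ℝ (Fin d),
      Complex.exp (-((p.1 * σ + ⟪p.2, ξ⟫ : ℝ) : ℂ) * Complex.I) * f p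

/-- The operator `Lf(s,x) = ∂f/∂s(s,x) - (2π)^{-d/2} ∫ e^{ix·ξ} q(s,x,ξ) (f(s,·))^∧(ξ) dξ`. -/
noncomputable def Lop (d : ℕ)
    (q : ℝ → EuclideanSpace ℝ (Fin d) → EuclideanSpace ℝ (Fin d) → ℂ)
    (f : ℝ × EuclideanSpace ℝ (Fin d) → ℂ) (s : ℝ) (x : EuclideanSpace ℝ (Fin d)) : ℂ :=
  deriv (fun r : ℝ => f (r, x)) s -
    (((2 * Real.pi) ^ (-(d : ℝ) / 2) : ℝ) : ℂ) *
      ∫ ξ : EuclideanSpace ℝ (Fin d),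
        Complex.exp ((⟪x, ξ⟫ : ℝ) * Complex.I) * q s x ξ * fourierD d (fun y => f (s, y)) ξ

section General

open FourierTransform SchwartzMap

/-- A Schwartz function times a measurable function of at most quadratic growth is integrable. -/
theorem SchwartzMap.integrable_mul_of_norm_le_sq {V : Type*} [NormedAddCommGroup V]
    [NormedSpace ℝ V] [MeasurableSpace V] [BorelSpace V] [SecondCountableTopology V]
    {μ : Measure V} [μ.HasTemperateGrowth]
    (H : 𝓢(V, ℂ)) {m : V → ℂ} (hm : AEStronglyMeasurable m μ) {K : ℝ}
    (hK : ∀ v, ‖m v‖ ≤ K * (1 + ‖v‖ ^ 2)) : Integrable (fun v => m v * H v) μ := by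
  have h := ((H.integrable (μ := μ)).norm.add (H.integrable_pow_mul μ 2)).const_mul K
  refine h.mono' (hm.mul H.continuous.aestronglyMeasurable) (Eventually.of_forall fun v => ?_)
  rw [norm_mul]
  calc ‖m v‖ * ‖H v‖ ≤ (K * (1 + ‖v‖ ^ 2)) * ‖H v‖ := by gcongr; exact hK v
    _ = _ := by simp only [Pi.add_apply]; ring

variable {V : Type*} [NormedAddCommGroup V] [InnerProductSpace ℝ V] [MeasurableSpace V]
  [BorelSpace V] [FiniteDimensional ℝ V]

/-- The Fourier integral in angular frequency in terms of Mathlib's Fourier transform. -/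
theorem integral_cexp_neg_inner_mul (g : V → ℂ) (ξ : V) :
    ∫ x : V, Complex.exp (-(⟪x, ξ⟫ : ℝ) * Complex.I) * g x = 𝓕 g ((2 * Real.pi)⁻¹ • ξ) := by
  rw [Real.fourier_eq']
  refine integral_congr_ae (Eventually.of_forall fun x => ?_)
  have : (-2 * Real.pi * ⟪x, (2 * Real.pi)⁻¹ • ξ⟫ : ℝ) = -⟪x, ξ⟫ := by
    rw [inner_smul_right]
    field_simp
  simp only [this, smul_eq_mul, Complex.ofReal_neg]

/-- Fourier inversion in angular frequency. -/
theorem integral_cexp_inner_mul_fourier {g : V → ℂ} {x : V} (hc : ContinuousAt g x)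
    (hi : Integrable g) (hF : Integrable (𝓕 g)) :
    ∫ ξ : V, Complex.exp ((⟪x, ξ⟫ : ℝ) * Complex.I) * 𝓕 g ((2 * Real.pi)⁻¹ • ξ) =
      (((2 * Real.pi) ^ Module.finrank ℝ V : ℝ) : ℂ) * g x := by
  have h2 := hi.fourierInv_fourier_eq hF hc
  rw [Real.fourierInv_eq'] at h2
  have h3 := Measure.integral_comp_inv_smul_of_nonneg (volume : Measure V)
    (fun v : V => Complex.exp ((2 * Real.pi * ⟪v, x⟫ : ℝ) * Complex.I) • 𝓕 g v)
    (R := 2 * Real.pi) (by positivity)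
  rw [h2] at h3
  rw [← Complex.real_smul, ← h3]
  refine integral_congr_ae (Eventually.of_forall fun ξ => ?_)
  have : (2 * Real.pi * ⟪(2 * Real.pi)⁻¹ • ξ, x⟫ : ℝ) = ⟪x, ξ⟫ := by
    rw [real_inner_smul_left, real_inner_comm]
    field_simp
  simp only [this, smul_eq_mul]

end General

section SpaceTime

open FourierTransform LineDeriv SchwartzMap

variable {d : ℕ}

local notation "E" => EuclideanSpace ℝ (Fin d)

theorem fourierD_eq_fourier (g : E → ℂ) (ξ : E) :
    fourierD d g ξ =
      (((2 * Real.pi) ^ (-(d : ℝ) / 2) : ℝ) : ℂ) * 𝓕 g ((2 * Real.pi)⁻¹ • ξ) := by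
  rw [fourierD, integral_cexp_neg_inner_mul]

theorem integral_withLp_prod (g : WithLp 2 (ℝ × E) → ℂ) :
    ∫ p : ℝ × E, g (WithLp.toLp 2 p) = ∫ v, g v :=
  (WithLp.volume_preserving_toLp ℝ E).integral_comp
    (MeasurableEquiv.toLp 2 (ℝ × E)).measurableEmbedding g

theorem inner_withLp_prod (v w : WithLp 2 (ℝ × E)) :
    (⟪v, w⟫ : ℝ) = v.fst * w.fst + ⟪v.snd, w.snd⟫ := by
  rw [WithLp.prod_inner_apply]
  simp [mul_comm]

theorem fourierTD_eq_fourier (f : ℝ × E → ℂ) (σ : ℝ) (ξ : E) :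
    fourierTD d f σ ξ = (((2 * Real.pi) ^ (-((1 : ℝ) + d) / 2) : ℝ) : ℂ) *
      𝓕 (fun v : WithLp 2 (ℝ × E) => f v.ofLp)
        ((2 * Real.pi)⁻¹ • WithLp.toLp 2 (σ, ξ)) := by
  rw [fourierTD, ← integral_cexp_neg_inner_mul, ← integral_withLp_prod]
  simp only [inner_withLp_prod]
  rfl

/-- Scaling by `(2π)⁻¹` followed by the identification `ℝ × ℝ^d ≃ WithLp 2 (ℝ × ℝ^d)`. -/
noncomputable def angularEquiv (d : ℕ) :
    (ℝ × EuclideanSpace ℝ (Fin d)) ≃L[ℝ] WithLp 2 (ℝ × EuclideanSpace ℝ (Fin d)) :=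
  (WithLp.prodContinuousLinearEquiv 2 ℝ ℝ (EuclideanSpace ℝ (Fin d))).symm.trans
    (ContinuousLinearEquiv.smulLeft (Units.mk0 (2 * Real.pi)⁻¹ (by positivity)))

theorem angularEquiv_apply (p : ℝ × E) :
    angularEquiv d p = (2 * Real.pi)⁻¹ • WithLp.toLp 2 p := rfl

/-- A smooth compactly supported function on `ℝ × ℝ^d` as a Schwartz function on the
`L²`-product. -/
noncomputable def withLpSchwartz {f : ℝ × E → ℂ} (hf : ContDiff ℝ (⊤ : ℕ∞) f)
    (hsupp : HasCompactSupport f) : 𝓢(WithLp 2 (ℝ × E), ℂ) :=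
  SchwartzMap.compCLMOfContinuousLinearEquiv ℝ (WithLp.prodContinuousLinearEquiv 2 ℝ ℝ E)
    (hsupp.toSchwartzMap hf)

theorem coe_withLpSchwartz {f : ℝ × E → ℂ} (hf : ContDiff ℝ (⊤ : ℕ∞) f)
    (hsupp : HasCompactSupport f) :
    ⇑(withLpSchwartz hf hsupp) = fun v : WithLp 2 (ℝ × E) => f v.ofLp := rfl

/-- The space-time Fourier transform of a test function as a Schwartz function. -/
noncomputable def fourierTDSchwartz {f : ℝ × E → ℂ} (hf : ContDiff ℝ (⊤ : ℕ∞) f)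
    (hsupp : HasCompactSupport f) : 𝓢(ℝ × E, ℂ) :=
  (((2 * Real.pi) ^ (-((1 : ℝ) + d) / 2) : ℝ) : ℂ) •
    SchwartzMap.compCLMOfContinuousLinearEquiv ℝ (angularEquiv d) (𝓕 (withLpSchwartz hf hsupp))

theorem fourierTDSchwartz_apply {f : ℝ × E → ℂ} (hf : ContDiff ℝ (⊤ : ℕ∞) f)
    (hsupp : HasCompactSupport f) (p : ℝ × E) :
    fourierTDSchwartz hf hsupp p = fourierTD d f p.1 p.2 := by
  rw [fourierTD_eq_fourier, ← coe_withLpSchwartz hf hsupp, ← SchwartzMap.fourier_coe]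
  rfl

/-- The Fourier transform in space of a test function as a Schwartz function. -/
theorem exists_schwartz_fourierD {g : E → ℂ} (hg : ContDiff ℝ (⊤ : ℕ∞) g)
    (hsupp : HasCompactSupport g) : ∃ H : 𝓢(E, ℂ), ∀ ξ, H ξ = fourierD d g ξ := by
  refine ⟨(((2 * Real.pi) ^ (-(d : ℝ) / 2) : ℝ) : ℂ) •
    SchwartzMap.compCLMOfContinuousLinearEquiv ℝ
      (ContinuousLinearEquiv.smulLeft (Units.mk0 (2 * Real.pi)⁻¹ (by positivity)) : E ≃L[ℝ] E)
      (𝓕 (hsupp.toSchwartzMap hg)), fun ξ => ?_⟩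
  rw [fourierD_eq_fourier]
  change _ * (𝓕 (hsupp.toSchwartzMap hg)) ((2 * Real.pi)⁻¹ • ξ) = _
  rw [SchwartzMap.fourier_coe]
  rfl

/-- The power of `2π` produced by applying the space-time transform and its inverse. -/
theorem two_pi_rpow_mul_rpow_mul_pow (d : ℕ) :
    (2 * Real.pi) ^ (-((d : ℝ) + 1) / 2) *
      ((2 * Real.pi) ^ (-((1 : ℝ) + d) / 2) * (2 * Real.pi) ^ (d + 1)) = 1 := by
  rw [← Real.rpow_natCast, ← Real.rpow_add (by positivity), ← Real.rpow_add (by positivity)]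
  refine (congrArg _ ?_).trans (Real.rpow_zero _)
  push_cast
  ring

/-- The time derivative is the Fourier multiplier with symbol `iσ`. -/
theorem deriv_fst_eq_integral_fourierTD {f : ℝ × E → ℂ} (hf : ContDiff ℝ (⊤ : ℕ∞) f)
    (hsupp : HasCompactSupport f) (s : ℝ) (x : E) :
    deriv (fun r : ℝ => f (r, x)) s = (((2 * Real.pi) ^ (-((d : ℝ) + 1) / 2) : ℝ) : ℂ) *
      ∫ p : ℝ × E, Complex.exp (((s * p.1 + ⟪x, p.2⟫ : ℝ) : ℂ) * Complex.I) *
        (Complex.I * p.1) * fourierTD d f p.1 p.2 := by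
  set g := withLpSchwartz hf hsupp with hg
  set m : WithLp 2 (ℝ × E) := WithLp.toLp 2 (1, 0) with hm
  set g' : 𝓢(WithLp 2 (ℝ × E), ℂ) := ∂_{m} g with hg'
  have hderiv : g' (WithLp.toLp 2 (s, x)) = deriv (fun r : ℝ => f (r, x)) s := by
    rw [hg', SchwartzMap.lineDerivOp_apply_eq_fderiv]
    have h1 : HasDerivAt (fun r : ℝ => (WithLp.toLp 2 (r, x) : WithLp 2 (ℝ × E))) m s := by
      have := ((WithLp.prodContinuousLinearEquiv 2 ℝ ℝ E).symm.hasFDerivAt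
        (x := (s, x))).comp_hasDerivAt s ((hasDerivAt_id s).prodMk (hasDerivAt_const s x))
      exact this
    exact ((g.differentiableAt.hasFDerivAt (x := WithLp.toLp 2 (s, x))).comp_hasDerivAt s
      h1).deriv.symm
  have hmul : ∀ v, 𝓕 (⇑g') v = (2 * Real.pi * Complex.I) * (v.fst * 𝓕 (⇑g) v) := by
    intro v
    have ht : (inner ℝ · m : WithLp 2 (ℝ × E) → ℝ).HasTemperateGrowth := by fun_prop
    rw [← SchwartzMap.fourier_coe, hg', SchwartzMap.fourier_lineDerivOp_eq, _root_.smul_apply,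
      SchwartzMap.smulLeftCLM_apply_apply ht, inner_withLp_prod, SchwartzMap.fourier_coe]
    simp [hm]
  have hinv := integral_cexp_inner_mul_fourier (x := WithLp.toLp 2 (s, x))
    g'.continuous.continuousAt g'.integrable
    (by rw [← SchwartzMap.fourier_coe]; exact (𝓕 g').integrable)
  rw [hderiv, ← integral_withLp_prod] at hinv
  have hfin : Module.finrank ℝ (WithLp 2 (ℝ × E)) = d + 1 := by
    rw [(WithLp.linearEquiv 2 ℝ (ℝ × E)).finrank_eq]
    simp [add_comm]
  have hrw : ∀ p : ℝ × E, Complex.exp (((s * p.1 + ⟪x, p.2⟫ : ℝ) : ℂ) * Complex.I) *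
        (Complex.I * p.1) * fourierTD d f p.1 p.2 =
      (((2 * Real.pi) ^ (-((1 : ℝ) + d) / 2) : ℝ) : ℂ) *
      (Complex.exp ((⟪(WithLp.toLp 2 (s, x) : WithLp 2 (ℝ × E)), WithLp.toLp 2 p⟫ : ℝ) * Complex.I)
        * 𝓕 (⇑g') ((2 * Real.pi)⁻¹ • WithLp.toLp 2 p)) := by
    rintro ⟨σ, ξ⟩
    rw [hmul, inner_withLp_prod, fourierTD_eq_fourier, hg, coe_withLpSchwartz]
    have : (2 * Real.pi : ℂ) ≠ 0 := by simp [Real.pi_ne_zero]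
    simp only [WithLp.smul_fst, WithLp.toLp_fst, WithLp.toLp_snd, smul_eq_mul, Complex.ofReal_mul, Complex.ofReal_inv,
      Complex.ofReal_ofNat]
    field_simp
  simp_rw [hrw]
  rw [integral_const_mul, hinv, hfin, ← mul_assoc, ← mul_assoc, ← Complex.ofReal_mul,
    ← Complex.ofReal_mul, mul_assoc, two_pi_rpow_mul_rpow_mul_pow]
  simp

/-- Inverting the space-time Fourier transform in the time variable alone. -/
theorem integral_fst_fourierTD {f : ℝ × E → ℂ} (hf : Continuous f) (hsupp : HasCompactSupport f)
    (s : ℝ) (ξ : E) (hint : Integrable fun σ => fourierTD d f σ ξ) :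
    (((2 * Real.pi) ^ (-((d : ℝ) + 1) / 2) : ℝ) : ℂ) *
      ∫ σ : ℝ, Complex.exp ((s * σ : ℝ) * Complex.I) * fourierTD d f σ ξ =
    (((2 * Real.pi) ^ (-(d : ℝ) / 2) : ℝ) : ℂ) * fourierD d (fun y => f (s, y)) ξ := by
  set G : ℝ → ℂ := fun r => ∫ y : E, Complex.exp (-(⟪y, ξ⟫ : ℝ) * Complex.I) * f (r, y) with hG
  have hFi : Integrable fun p : ℝ × E => Complex.exp (-(⟪p.2, ξ⟫ : ℝ) * Complex.I) * f p :=
    Continuous.integrable_of_hasCompactSupport (by fun_prop) hsupp.mul_left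
  have hGi : Integrable G := by
    rw [Measure.volume_eq_prod] at hFi
    exact hFi.integral_prod_left
  have hGc : Continuous G := by
    rw [← continuousOn_univ]
    refine continuousOn_integral_of_compact_support (k := Prod.snd '' tsupport f)
      (hsupp.isCompact.image continuous_snd) ?_ ?_
    · exact Continuous.continuousOn (by fun_prop)
    · intro r y _ hy
      rw [image_eq_zero_of_notMem_tsupport fun h => hy ⟨_, h, rfl⟩, mul_zero]
  set C : ℂ := (((2 * Real.pi) ^ (-((1 : ℝ) + d) / 2) : ℝ) : ℂ) with hC
  have hC0 : C ≠ 0 := Complex.ofReal_ne_zero.2 (by positivity)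
  have hTD : ∀ σ, fourierTD d f σ ξ = C * 𝓕 G ((2 * Real.pi)⁻¹ • σ) := by
    intro σ
    have hi : Integrable fun p : ℝ × E =>
        Complex.exp (-((p.1 * σ + ⟪p.2, ξ⟫ : ℝ) : ℂ) * Complex.I) * f p :=
      Continuous.integrable_of_hasCompactSupport (by fun_prop) hsupp.mul_left
    rw [Measure.volume_eq_prod] at hi
    rw [fourierTD, ← integral_cexp_neg_inner_mul, Measure.volume_eq_prod, integral_prod _ hi]
    congr 2
    ext r
    rw [hG, ← integral_const_mul]
    congr 1
    ext y
    rw [← mul_assoc, ← Complex.exp_add]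
    congr 2
    simp
    ring
  have hFG : Integrable (𝓕 G) := by
    simp_rw [hTD] at hint
    have h1 := (integrable_const_mul_iff hC0.isUnit _).1 hint
    exact (integrable_comp_smul_iff volume (𝓕 G) (by positivity)).1 h1
  have hinv := integral_cexp_inner_mul_fourier (x := s) hGc.continuousAt hGi hFG
  have hrw : ∀ σ : ℝ, Complex.exp ((s * σ : ℝ) * Complex.I) * fourierTD d f σ ξ =
      C * (Complex.exp ((⟪s, σ⟫ : ℝ) * Complex.I) * 𝓕 G ((2 * Real.pi)⁻¹ • σ)) := by
    intro σ
    rw [hTD, real_inner_comm]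
    simp only [RCLike.inner_apply, conj_trivial]
    ring
  simp_rw [hrw]
  rw [integral_const_mul, hinv, fourierD, hC, Module.finrank_self, pow_one, ← mul_assoc,
    ← mul_assoc, ← mul_assoc, ← Complex.ofReal_mul, ← Complex.ofReal_mul, ← Complex.ofReal_mul]
  congr 2
  rw [← Real.rpow_add (by positivity), ← Real.rpow_add (by positivity),
    ← Real.rpow_add_one (by positivity)]
  congr 1
  ring

end SpaceTime

/-- For a measurable symbol `q` with `|q(s,x,ξ)| ≤ c(1+|ξ|²)` and
`f ∈ C_c^∞(ℝ × ℝ^d; ℂ)`, both defining integrals converge absolutely and `-L` is the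
pseudo-differential operator with symbol `q_L((s,x),(σ,ξ)) = -iσ + q(s,x,ξ)`:
`-Lf(s,x) = (2π)^{-(d+1)/2} ∫∫ e^{i(sσ+x·ξ)} (-iσ + q(s,x,ξ)) f̂(σ,ξ) dσ dξ`. -/
theorem spaceTime_symbol
    (d : ℕ) (hd : 1 ≤ d) (c : ℝ) (hc : 0 < c)
    (q : ℝ → EuclideanSpace ℝ (Fin d) → EuclideanSpace ℝ (Fin d) → ℂ)
    (hqmeas : Measurable (fun p : ℝ × EuclideanSpace ℝ (Fin d) × EuclideanSpace ℝ (Fin d) =>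
      q p.1 p.2.1 p.2.2))
    (hqbound : ∀ s x ξ, ‖q s x ξ‖ ≤ c * (1 + ‖ξ‖ ^ 2))
    (f : ℝ × EuclideanSpace ℝ (Fin d) → ℂ)
    (hf : ContDiff ℝ (⊤ : ℕ∞) f) (hsupp : HasCompactSupport f) :
    ∀ (s : ℝ) (x : EuclideanSpace ℝ (Fin d)),
      Integrable (fun ξ : EuclideanSpace ℝ (Fin d) =>
        Complex.exp ((⟪x, ξ⟫ : ℝ) * Complex.I) * q s x ξ * fourierD d (fun y => f (s, y)) ξ) ∧
      Integrable (fun p : ℝ × EuclideanSpace ℝ (Fin d) =>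
        Complex.exp (((s * p.1 + ⟪x, p.2⟫ : ℝ) : ℂ) * Complex.I) *
          (-Complex.I * p.1 + q s x p.2) * fourierTD d f p.1 p.2) ∧
      -Lop d q f s x =
        (((2 * Real.pi) ^ (-((d : ℝ) + 1) / 2) : ℝ) : ℂ) *
          ∫ p : ℝ × EuclideanSpace ℝ (Fin d),
            Complex.exp (((s * p.1 + ⟪x, p.2⟫ : ℝ) : ℂ) * Complex.I) *
              (-Complex.I * p.1 + q s x p.2) * fourierTD d f p.1 p.2 := by
  intro s x
  have hq : Measurable (q s x) :=
    hqmeas.comp (measurable_const.prodMk (measurable_const.prodMk measurable_id))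
  have hexp : ∀ t : ℝ, ‖Complex.exp ((t : ℂ) * Complex.I)‖ = 1 := Complex.norm_exp_ofReal_mul_I
  have hint1 : Integrable (fun ξ : EuclideanSpace ℝ (Fin d) =>
      Complex.exp ((⟪x, ξ⟫ : ℝ) * Complex.I) * q s x ξ * fourierD d (fun y => f (s, y)) ξ) := by
    have hemb : Topology.IsClosedEmbedding (fun y : EuclideanSpace ℝ (Fin d) => (s, y)) :=
      Topology.IsClosedEmbedding.of_continuous_injective_isClosedMap (by fun_prop)
        (Prod.mk_right_injective s) (isClosedMap_prodMk_left s)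
    obtain ⟨H, hH⟩ := exists_schwartz_fourierD (hf.comp (contDiff_prodMk_right s))
      (hsupp.comp_isClosedEmbedding hemb)
    have := H.integrable_mul_of_norm_le_sq (μ := volume) (K := c)
      (m := fun ξ => Complex.exp ((⟪x, ξ⟫ : ℝ) * Complex.I) * q s x ξ)
      (by fun_prop) (fun ξ => by rw [norm_mul, hexp, one_mul]; exact hqbound s x ξ)
    simpa only [hH] using! this
  have : (volume : Measure (ℝ × EuclideanSpace ℝ (Fin d))).HasTemperateGrowth := by
    rw [Measure.volume_eq_prod]
    infer_instance
  set H := fourierTDSchwartz hf hsupp with hHdef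
  have hH : ∀ p, H p = fourierTD d f p.1 p.2 := fourierTDSchwartz_apply hf hsupp
  have hintt : Integrable (fun p : ℝ × EuclideanSpace ℝ (Fin d) =>
      Complex.exp (((s * p.1 + ⟪x, p.2⟫ : ℝ) : ℂ) * Complex.I) *
        (Complex.I * p.1) * fourierTD d f p.1 p.2) := by
    have := H.integrable_mul_of_norm_le_sq (μ := volume) (K := 1)
      (m := fun p => Complex.exp (((s * p.1 + ⟪x, p.2⟫ : ℝ) : ℂ) * Complex.I) *
        (Complex.I * p.1)) (by fun_prop) (fun p => by
          rw [norm_mul, hexp, norm_mul, Complex.norm_I, Complex.norm_real]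
          nlinarith [norm_fst_le p, sq_nonneg (‖p‖ - 1)])
    simpa only [hH] using this
  have hintq : Integrable (fun p : ℝ × EuclideanSpace ℝ (Fin d) =>
      Complex.exp (((s * p.1 + ⟪x, p.2⟫ : ℝ) : ℂ) * Complex.I) *
        q s x p.2 * fourierTD d f p.1 p.2) := by
    have := H.integrable_mul_of_norm_le_sq (μ := volume) (K := c)
      (m := fun p => Complex.exp (((s * p.1 + ⟪x, p.2⟫ : ℝ) : ℂ) * Complex.I) * q s x p.2)
      (by
        have : Measurable fun p : ℝ × EuclideanSpace ℝ (Fin d) => q s x p.2 :=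
          hq.comp measurable_snd
        fun_prop)
      (fun p => by
        rw [norm_mul, hexp, one_mul]
        refine (hqbound s x p.2).trans ?_
        gcongr
        exact norm_snd_le p)
    simpa only [hH] using this
  have hsplit : (fun p : ℝ × EuclideanSpace ℝ (Fin d) =>
      Complex.exp (((s * p.1 + ⟪x, p.2⟫ : ℝ) : ℂ) * Complex.I) *
        (-Complex.I * p.1 + q s x p.2) * fourierTD d f p.1 p.2) = fun p =>
      Complex.exp (((s * p.1 + ⟪x, p.2⟫ : ℝ) : ℂ) * Complex.I) *
        q s x p.2 * fourierTD d f p.1 p.2 -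
      Complex.exp (((s * p.1 + ⟪x, p.2⟫ : ℝ) : ℂ) * Complex.I) *
        (Complex.I * p.1) * fourierTD d f p.1 p.2 := by
    ext p
    ring
  have hspace : (((2 * Real.pi) ^ (-((d : ℝ) + 1) / 2) : ℝ) : ℂ) *
      ∫ p : ℝ × EuclideanSpace ℝ (Fin d),
        Complex.exp (((s * p.1 + ⟪x, p.2⟫ : ℝ) : ℂ) * Complex.I) *
          q s x p.2 * fourierTD d f p.1 p.2 =
      (((2 * Real.pi) ^ (-(d : ℝ) / 2) : ℝ) : ℂ) * ∫ ξ : EuclideanSpace ℝ (Fin d),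
        Complex.exp ((⟪x, ξ⟫ : ℝ) * Complex.I) * q s x ξ * fourierD d (fun y => f (s, y)) ξ := by
    have hHi : Integrable (fun p : ℝ × EuclideanSpace ℝ (Fin d) => fourierTD d f p.1 p.2) :=
      (H.integrable (μ := volume)).congr (Eventually.of_forall hH)
    rw [Measure.volume_eq_prod] at hintq hHi ⊢
    rw [integral_prod_symm _ hintq, ← integral_const_mul, ← integral_const_mul]
    refine integral_congr_ae ?_
    filter_upwards [hHi.prod_left_ae] with ξ hξ
    have hinv := integral_fst_fourierTD hf.continuous hsupp s ξ hξ
    have hrw : ∀ σ : ℝ, Complex.exp (((s * σ + ⟪x, ξ⟫ : ℝ) : ℂ) * Complex.I) *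
        q s x ξ * fourierTD d f σ ξ = Complex.exp ((⟪x, ξ⟫ : ℝ) * Complex.I) * q s x ξ *
          (Complex.exp ((s * σ : ℝ) * Complex.I) * fourierTD d f σ ξ) := by
      intro σ
      rw [Complex.ofReal_add, add_mul, Complex.exp_add]
      ring
    simp_rw [hrw]
    rw [integral_const_mul, mul_left_comm, hinv]
    ring
  refine ⟨hint1, ?_, ?_⟩
  · rw [hsplit]
    exact hintq.sub hintt
  · rw [hsplit, integral_sub hintq hintt, mul_sub, hspace, Lop,
      deriv_fst_eq_integral_fourierTD hf hsupp]
    ring
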